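/- Let f be a log-concave probability density on ℝⁿ and let p ≥ q > 0 with p, q ≠ 1. Then h_q(f) − h_p(f) ≤ n·(log q)/(q−1) − n·(log p)/(p−1) (where (log α)/(α−1) is interpreted as 1 at α = 1). Equivalently, the quantity h_α(f) − n·(log α)/(α−1) is non-decreasing in α on (0,∞). -/

import Mathlib

open MeasureTheory Real
open scoped Classical

/-- A function `f : ℝⁿ → ℝ` is log-concave if `f = e^{-V}` for some convex
`V : ℝⁿ → (-∞, +∞]`, encoded as a real-valued convex function `V` on a convex set `s`
(with `V = +∞`, i.e. `f = 0`, outside `s`). -/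
def IsLogConcaveFnN {n : ℕ} (f : EuclideanSpace ℝ (Fin n) → ℝ) : Prop :=
  ∃ (s : Set (EuclideanSpace ℝ (Fin n))) (V : EuclideanSpace ℝ (Fin n) → ℝ),
    ConvexOn ℝ s V ∧ ∀ x, f x = if x ∈ s then Real.exp (-V x) else 0

lemma bm_compact {A B : Set ℝ} (hA : IsCompact A) (hB : IsCompact B) (hA' : A.Nonempty)
    (hB' : B.Nonempty) {S : Set ℝ} (hS : ∀ x ∈ A, ∀ y ∈ B, x + y ∈ S) :
    volume A + volume B ≤ volume S := by
  have hM := hA.sSup_mem hA'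
  have hm := hB.sInf_mem hB'
  set M := sSup A
  set m := sInf B
  have hMA : ∀ x ∈ A, x ≤ M := fun x hx => le_csSup hA.bddAbove hx
  have hmB : ∀ x ∈ B, m ≤ x := fun x hx => csInf_le hB.bddBelow hx
  have e1 : volume ((fun x => x + m) '' A) = volume A := by
    simp [Set.image_add_right]
  have e2 : volume ((fun x => M + x) '' B) = volume B := by
    simp [Set.image_add_left]
  rw [← e1, ← e2, ← measure_union₀]
  · apply measure_mono
    rintro _ (⟨x, hx, rfl⟩ | ⟨x, hx, rfl⟩)
    · exact hS _ hx _ hm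
    · exact hS _ hM _ hx
  · exact (hB.image (by fun_prop)).measurableSet.nullMeasurableSet
  · refine measure_mono_null (t := {M + m}) ?_ (by simp)
    rintro _ ⟨⟨x, hx, rfl⟩, ⟨y, hy, h⟩⟩
    have := hMA x hx
    have := hmB y hy
    simp only at h ⊢
    simp only [Set.mem_singleton_iff]
    linarith

lemma add_le_of_compact {A : Set ℝ} (hA : MeasurableSet A) (hA' : A.Nonempty) {c d : ENNReal}
    (h : ∀ K ⊆ A, IsCompact K → K.Nonempty → volume K + d ≤ c) : volume A + d ≤ c := by
  obtain ⟨x, hx⟩ := hA'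
  have h0 := h {x} (by simpa using hx) isCompact_singleton (by simp)
  simp only [Real.volume_singleton, zero_add] at h0
  by_cases hd : d = ⊤
  · subst hd; simp at h0; simp [h0]
  refine add_le_of_le_tsub_right_of_le h0 (le_of_forall_lt fun r hr => ?_)
  obtain ⟨K, hK, hKc, hr'⟩ := hA.exists_lt_isCompact hr
  refine lt_of_lt_of_le hr' (ENNReal.le_sub_of_add_le_right hd (h K hK hKc ?_))
  by_contra hne
  rw [Set.not_nonempty_iff_eq_empty] at hne
  simp [hne] at hr'

lemma bm_add {A B : Set ℝ} (hA : MeasurableSet A) (hB : MeasurableSet B) (hA' : A.Nonempty)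
    (hB' : B.Nonempty) {S : Set ℝ} (hS : ∀ x ∈ A, ∀ y ∈ B, x + y ∈ S) :
    volume A + volume B ≤ volume S := by
  refine add_le_of_compact hA hA' fun K hK hKc hKn => ?_
  rw [add_comm]
  refine add_le_of_compact hB hB' fun L hL hLc hLn => ?_
  rw [add_comm]
  exact bm_compact hKc hLc hKn hLn fun x hx y hy => hS x (hK hx) y (hL hy)

lemma bm_scaled {a b : ℝ} (ha : 0 < a) (hb : 0 < b)
    {A B : Set ℝ} (hA : MeasurableSet A) (hB : MeasurableSet B) (hA' : A.Nonempty)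
    (hB' : B.Nonempty) {S : Set ℝ} (hS : ∀ x ∈ A, ∀ y ∈ B, a * x + b * y ∈ S) :
    ENNReal.ofReal a * volume A + ENNReal.ofReal b * volume B ≤ volume S := by
  open scoped Pointwise in
  have h := bm_add (A := a • A) (B := b • B) (S := S) (hA.const_smul_of_ne_zero ha.ne')
    (hB.const_smul_of_ne_zero hb.ne') hA'.smul_set hB'.smul_set ?_
  · simpa [Measure.addHaar_smul, abs_of_pos ha, abs_of_pos hb] using h
  · rintro _ ⟨x, hx, rfl⟩ _ ⟨y, hy, rfl⟩
    exact hS x hx y hy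

lemma ennreal_amgm {a b : ℝ} (ha : 0 < a) (hb : 0 < b) (hab : a + b = 1) (x y : ENNReal) :
    x ^ a * y ^ b ≤ ENNReal.ofReal a * x + ENNReal.ofReal b * y := by
  by_cases hx : x = ⊤
  · simp [hx, ENNReal.mul_top, ha]
  by_cases hy : y = ⊤
  · simp [hy, ENNReal.mul_top, hb]
  lift x to NNReal using hx
  lift y to NNReal using hy
  lift a to NNReal using ha.le
  lift b to NNReal using hb.le
  have := NNReal.geom_mean_le_arith_mean2_weighted a b x y (by exact_mod_cast hab)
  rw [← ENNReal.coe_rpow_of_nonneg _ ha.le, ← ENNReal.coe_rpow_of_nonneg _ hb.le]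
  simp only [ENNReal.ofReal_coe_nnreal]
  exact_mod_cast this

lemma layer {F : ℝ → ENNReal} (hF : Measurable F) (h1 : ∀ x, F x ≤ 1) :
    ∫⁻ x, F x = ∫⁻ r in Set.Ioo (0:ℝ) 1, volume {x | ENNReal.ofReal r < F x} := by
  have hfin : ∀ x, F x ≠ ⊤ := fun x => ne_top_of_le_ne_top ENNReal.one_ne_top (h1 x)
  have e : ∫⁻ x, F x = ∫⁻ x, ENNReal.ofReal (F x).toReal := by
    simp [ENNReal.ofReal_toReal, hfin]
  rw [e, lintegral_eq_lintegral_meas_lt _ (by filter_upwards with x using ENNReal.toReal_nonneg)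
    hF.ennreal_toReal.aemeasurable]
  rw [← lintegral_indicator measurableSet_Ioi, ← lintegral_indicator measurableSet_Ioo]
  congr 1
  ext r
  by_cases h0 : 0 < r
  · by_cases hr : r < 1
    · simp only [Set.indicator, Set.mem_Ioi, Set.mem_Ioo, h0, hr, and_self, if_true]
      congr 1
      ext x
      simp [ENNReal.ofReal_lt_iff_lt_toReal h0.le (hfin x)]
    · simp only [Set.indicator, Set.mem_Ioi, Set.mem_Ioo, h0, hr, and_false, if_true, if_false]
      convert measure_empty (μ := volume)
      ext x
      simp only [Set.mem_ofPred_eq, Set.mem_empty_iff_false, iff_false, not_lt]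
      exact (ENNReal.toReal_mono ENNReal.one_ne_top (h1 x)).trans (by simpa using hr)
  · simp [Set.indicator, h0]

lemma pl_norm {a b : ℝ} (ha : 0 < a) (hb : 0 < b) (hab : a + b = 1) {F G H : ℝ → ENNReal}
    (hF : Measurable F) (hG : Measurable G) (hH : Measurable H)
    (sF : ⨆ x, F x = 1) (sG : ⨆ x, G x = 1)
    (h : ∀ x y, F x ^ a * G y ^ b ≤ H (a * x + b * y)) :
    ENNReal.ofReal a * (∫⁻ x, F x) + ENNReal.ofReal b * (∫⁻ x, G x) ≤ ∫⁻ x, H x := by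
  have F1 : ∀ x, F x ≤ 1 := fun x => sF ▸ le_iSup F x
  have G1 : ∀ x, G x ≤ 1 := fun x => sG ▸ le_iSup G x
  have hmeasF : ∀ F : ℝ → ENNReal, Measurable (fun r : ℝ => volume {x | ENNReal.ofReal r < F x}) := by
    intro F
    apply Antitone.measurable
    intro r s hrs
    exact measure_mono fun x hx => lt_of_le_of_lt (ENNReal.ofReal_le_ofReal hrs) hx
  calc _ ≤ ∫⁻ x, min (H x) 1 := by
        rw [layer hF F1, layer hG G1, layer (hH.min measurable_const) (fun x => min_le_right _ _),
          ← lintegral_const_mul _ (hmeasF F), ← lintegral_const_mul _ (hmeasF G),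
          ← lintegral_add_left ((hmeasF F).const_mul _)]
        refine setLIntegral_mono' measurableSet_Ioo fun r hr => ?_
        have hr1 : ENNReal.ofReal r < 1 := by simpa using hr.2
        have hr0 : 0 < ENNReal.ofReal r := by simpa using hr.1
        refine bm_scaled ha hb (measurableSet_lt measurable_const hF)
          (measurableSet_lt measurable_const hG) ?_ ?_ ?_
        · rw [← sF, lt_iSup_iff] at hr1; exact hr1
        · rw [← sG, lt_iSup_iff] at hr1; exact hr1
        · intro x hx y hy
          refine lt_min (lt_of_lt_of_le ?_ (h x y)) hr1
          calc ENNReal.ofReal r = ENNReal.ofReal r ^ a * ENNReal.ofReal r ^ b := by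
                rw [← ENNReal.rpow_add _ _ hr0.ne' ENNReal.ofReal_ne_top, hab, ENNReal.rpow_one]
            _ < _ := ENNReal.mul_lt_mul (ENNReal.rpow_lt_rpow hx ha) (ENNReal.rpow_lt_rpow hy hb)
    _ ≤ _ := lintegral_mono fun x => min_le_left _ _

lemma pl_bdd {a b : ℝ} (ha : 0 < a) (hb : 0 < b) (hab : a + b = 1) {F G H : ℝ → ENNReal}
    (hF : Measurable F) (hG : Measurable G) (hH : Measurable H)
    (sF : ⨆ x, F x ≠ ⊤) (sG : ⨆ x, G x ≠ ⊤)
    (h : ∀ x y, F x ^ a * G y ^ b ≤ H (a * x + b * y)) :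
    (∫⁻ x, F x) ^ a * (∫⁻ x, G x) ^ b ≤ ∫⁻ x, H x := by
  set A := ⨆ x, F x with hA
  set B := ⨆ x, G x with hB
  by_cases A0 : A = 0
  · have : F = 0 := by
      ext x; exact le_antisymm ((le_iSup F x).trans_eq A0) (zero_le)
    simp [this, ha]
  by_cases B0 : B = 0
  · have : G = 0 := by
      ext x; exact le_antisymm ((le_iSup G x).trans_eq B0) (zero_le)
    simp [this, hb]
  set C := (A⁻¹) ^ a * (B⁻¹) ^ b with hC
  have hC0 : C ≠ 0 := by
    simp [hC, ENNReal.rpow_eq_zero_iff, A0, B0, sF, sG, ha, hb, ha.not_gt, hb.not_gt]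
  have hCt : C ≠ ⊤ := by
    refine ENNReal.mul_ne_top ?_ ?_ <;> refine ENNReal.rpow_ne_top_of_nonneg (by positivity) ?_ <;>
      simpa
  have key := pl_norm ha hb hab (hF.const_mul A⁻¹) (hG.const_mul B⁻¹) (hH.const_mul C)
    (by rw [← ENNReal.mul_iSup, ← hA, ENNReal.inv_mul_cancel A0 sF])
    (by rw [← ENNReal.mul_iSup, ← hB, ENNReal.inv_mul_cancel B0 sG])
    (fun x y => by
      rw [ENNReal.mul_rpow_of_nonneg _ _ ha.le, ENNReal.mul_rpow_of_nonneg _ _ hb.le,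
        mul_mul_mul_comm]
      gcongr
      exact h x y)
  have key2 := (ennreal_amgm ha hb hab _ _).trans key
  rw [lintegral_const_mul _ hF, lintegral_const_mul _ hG, lintegral_const_mul _ hH,
    ENNReal.mul_rpow_of_nonneg _ _ ha.le, ENNReal.mul_rpow_of_nonneg _ _ hb.le,
        mul_mul_mul_comm] at key2
  exact (ENNReal.mul_le_mul_iff_right hC0 hCt).1 key2

lemma tendsto_trunc {F : ℝ → ENNReal} (hF : Measurable F) :
    Filter.Tendsto (fun n : ℕ => ∫⁻ x, min (F x) n) Filter.atTop (nhds (∫⁻ x, F x)) := by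
  refine lintegral_tendsto_of_tendsto_of_monotone
    (fun n => (hF.min measurable_const).aemeasurable) ?_ ?_
  · filter_upwards with x
    intro m n hmn
    dsimp only
    gcongr
  · filter_upwards with x
    have := (tendsto_const_nhds (x := F x)).min ENNReal.tendsto_nat_nhds_top
    simpa using this

lemma pl_one {a b : ℝ} (ha : 0 < a) (hb : 0 < b) (hab : a + b = 1) {F G H : ℝ → ENNReal}
    (hF : Measurable F) (hG : Measurable G) (hH : Measurable H)
    (h : ∀ x y, F x ^ a * G y ^ b ≤ H (a * x + b * y)) :
    (∫⁻ x, F x) ^ a * (∫⁻ x, G x) ^ b ≤ ∫⁻ x, H x := by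
  by_cases A0 : ∫⁻ x, F x = 0
  · simp [A0, ha]
  by_cases B0 : ∫⁻ x, G x = 0
  · simp [B0, hb]
  have hFt := ((ENNReal.continuous_rpow_const (y := a)).tendsto _).comp (tendsto_trunc hF)
  have hGt := ((ENNReal.continuous_rpow_const (y := b)).tendsto _).comp (tendsto_trunc hG)
  have := ENNReal.Tendsto.mul hFt (Or.inl (by simp [ENNReal.rpow_eq_zero_iff, A0, ha.not_gt])) hGt
    (Or.inl (by simp [ENNReal.rpow_eq_zero_iff, B0, hb.not_gt]))
  refine le_of_tendsto' this fun n => ?_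
  refine pl_bdd ha hb hab (hF.min measurable_const) (hG.min measurable_const) hH ?_ ?_ ?_
  · exact ne_top_of_le_ne_top (ENNReal.natCast_ne_top n) (iSup_le fun x => min_le_right _ _)
  · exact ne_top_of_le_ne_top (ENNReal.natCast_ne_top n) (iSup_le fun x => min_le_right _ _)
  · intro x y
    refine le_trans ?_ (h x y)
    gcongr <;> exact min_le_left _ _

lemma pl_pi {a b : ℝ} (ha : 0 < a) (hb : 0 < b) (hab : a + b = 1) (n : ℕ) :
    ∀ {F G H : (Fin n → ℝ) → ENNReal}
    (_ : Measurable F) (_ : Measurable G) (_ : Measurable H)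
    (_ : ∀ x y, F x ^ a * G y ^ b ≤ H (a • x + b • y)),
    (∫⁻ x, F x) ^ a * (∫⁻ x, G x) ^ b ≤ ∫⁻ x, H x := by
  induction n with
  | zero =>
    intro F G H hF hG hH h
    have hv : (volume : Measure (Fin 0 → ℝ)) = Measure.dirac 0 := by
      rw [volume_pi]; exact Measure.pi_of_empty _ _
    rw [hv, lintegral_dirac' _ hF, lintegral_dirac' _ hG, lintegral_dirac' _ hH]
    simpa using h 0 0
  | succ n ih =>
    intro F G H hF hG hH h
    set e := (MeasurableEquiv.piFinSuccAbove (fun _ : Fin (n+1) => ℝ) 0).symm with he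
    have hmp := (volume_preserving_piFinSuccAbove (fun _ : Fin (n+1) => ℝ) 0).symm
    have he1 : ∀ x y, e (x, y) = Fin.cons x y := fun x y => by
      simp [he, MeasurableEquiv.piFinSuccAbove]; rfl
    have red : ∀ F : (Fin (n+1) → ℝ) → ENNReal, Measurable F →
        ∫⁻ x, F x = ∫⁻ x : ℝ, ∫⁻ y : Fin n → ℝ, F (e (x, y)) := by
      intro F hF
      rw [← hmp.lintegral_comp hF]
      exact lintegral_prod (fun z => F (e z)) (hF.comp e.measurable).aemeasurable
    rw [red F hF, red G hG, red H hH]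
    have hme : ∀ F : (Fin (n+1) → ℝ) → ENNReal, Measurable F → 
        Measurable fun z : ℝ × (Fin n → ℝ) => F (e z) := fun F hF => hF.comp e.measurable
    refine pl_one ha hb hab (hme F hF).lintegral_prod_right' (hme G hG).lintegral_prod_right'
      (hme H hH).lintegral_prod_right' fun x y => ?_
    refine ih ((hme F hF).comp measurable_prodMk_left) ((hme G hG).comp measurable_prodMk_left)
      ((hme H hH).comp measurable_prodMk_left) fun u v => ?_
    refine (h _ _).trans (le_of_eq ?_)
    congr 1
    rw [he1, he1, he1]
    ext i
    refine Fin.cases ?_ (fun j => ?_) i <;> simp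

lemma pl_euc {a b : ℝ} (ha : 0 < a) (hb : 0 < b) (hab : a + b = 1) {n : ℕ}
    {F G H : EuclideanSpace ℝ (Fin n) → ENNReal}
    (hF : Measurable F) (hG : Measurable G) (hH : Measurable H)
    (h : ∀ x y, F x ^ a * G y ^ b ≤ H (a • x + b • y)) :
    (∫⁻ x, F x) ^ a * (∫⁻ x, G x) ^ b ≤ ∫⁻ x, H x := by
  have mp := PiLp.volume_preserving_toLp (Fin n)
  rw [← mp.lintegral_comp hF, ← mp.lintegral_comp hG, ← mp.lintegral_comp hH]
  refine pl_pi ha hb hab n (hF.comp mp.measurable) (hG.comp mp.measurable) (hH.comp mp.measurable)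
    fun x y => ?_
  simpa using h (WithLp.toLp 2 x) (WithLp.toLp 2 y)

lemma lintegral_scale {n : ℕ} {g : EuclideanSpace ℝ (Fin n) → ENNReal} (hg : Measurable g)
    {α : ℝ} (hα : 0 < α) :
    ∫⁻ x, g (α⁻¹ • x) = ENNReal.ofReal (α ^ n) * ∫⁻ x, g x := by
  rw [← lintegral_map (f := g) hg (measurable_const_smul α⁻¹),
    Measure.map_addHaar_smul _ (inv_ne_zero hα.ne'), lintegral_smul_measure]
  simp [abs_of_pos hα]

lemma persp {n : ℕ} {f : EuclideanSpace ℝ (Fin n) → ℝ} (hnonneg : ∀ x, 0 ≤ f x)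
    (hlc : IsLogConcaveFnN f) {a b α β : ℝ} (ha : 0 < a) (hb : 0 < b)
    (hα : 0 < α) (hβ : 0 < β) (x y : EuclideanSpace ℝ (Fin n)) :
    (f (α⁻¹ • x) ^ α) ^ a * (f (β⁻¹ • y) ^ β) ^ b ≤
      f ((a * α + b * β)⁻¹ • (a • x + b • y)) ^ (a * α + b * β) := by
  obtain ⟨s, V, hV, hf⟩ := hlc
  set γ := a * α + b * β with hγ
  have hγ0 : 0 < γ := by positivity
  by_cases hx : α⁻¹ • x ∈ s
  swap
  · rw [hf (α⁻¹ • x), if_neg hx, zero_rpow hα.ne', zero_rpow ha.ne', zero_mul]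
    exact rpow_nonneg (hnonneg _) _
  by_cases hy : β⁻¹ • y ∈ s
  swap
  · rw [hf (β⁻¹ • y), if_neg hy, zero_rpow hβ.ne', zero_rpow hb.ne', mul_zero]
    exact rpow_nonneg (hnonneg _) _
  have hw : a * α / γ + b * β / γ = 1 := by
    rw [← add_div, div_self hγ0.ne']
  have hz : γ⁻¹ • (a • x + b • y) = (a * α / γ) • (α⁻¹ • x) + (b * β / γ) • (β⁻¹ • y) := by
    rw [smul_smul, smul_smul, smul_add, smul_smul, smul_smul]
    congr 2 <;> field_simp
  have hmem : γ⁻¹ • (a • x + b • y) ∈ s := by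
    rw [hz]; exact hV.1 hx hy (by positivity) (by positivity) hw
  have hle : V (γ⁻¹ • (a • x + b • y)) ≤ (a * α / γ) * V (α⁻¹ • x) + (b * β / γ) * V (β⁻¹ • y) := by
    rw [hz]; exact hV.2 hx hy (by positivity) (by positivity) hw
  rw [hf (α⁻¹ • x), hf (β⁻¹ • y), hf (γ⁻¹ • _), if_pos hx, if_pos hy, if_pos hmem]
  simp only [← Real.exp_mul, ← Real.exp_add]
  apply Real.exp_le_exp.2
  have := mul_le_mul_of_nonneg_left hle hγ0.le
  have e : γ * ((a * α / γ) * V (α⁻¹ • x) + (b * β / γ) * V (β⁻¹ • y)) =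
      a * α * V (α⁻¹ • x) + b * β * V (β⁻¹ • y) := by field_simp
  rw [e] at this
  linarith

lemma phi_ineq {n : ℕ} {f : EuclideanSpace ℝ (Fin n) → ℝ} (hmeas : Measurable f)
    (hnonneg : ∀ x, 0 ≤ f x)
    (hlc : IsLogConcaveFnN f) {a b α β : ℝ} (ha : 0 < a) (hb : 0 < b) (hab : a + b = 1)
    (hα : 0 < α) (hβ : 0 < β) :
    (ENNReal.ofReal (α ^ n) * ∫⁻ x, ENNReal.ofReal (f x ^ α)) ^ a *
    (ENNReal.ofReal (β ^ n) * ∫⁻ x, ENNReal.ofReal (f x ^ β)) ^ b ≤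
    ENNReal.ofReal ((a * α + b * β) ^ n) * ∫⁻ x, ENNReal.ofReal (f x ^ (a * α + b * β)) := by
  have hm : ∀ γ : ℝ, Measurable fun x => ENNReal.ofReal (f x ^ γ) := fun γ =>
    (hmeas.pow_const γ).ennreal_ofReal
  rw [← lintegral_scale (hm _) hα, ← lintegral_scale (hm _) hβ,
    ← lintegral_scale (hm _) (by positivity : 0 < a * α + b * β)]
  refine pl_euc ha hb hab ((hm _).comp (measurable_const_smul _))
    ((hm _).comp (measurable_const_smul _)) ((hm _).comp (measurable_const_smul _)) fun x y => ?_
  have h1 := rpow_nonneg (hnonneg (α⁻¹ • x)) α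
  have h2 := rpow_nonneg (hnonneg (β⁻¹ • y)) β
  rw [ENNReal.ofReal_rpow_of_nonneg h1 ha.le,
    ENNReal.ofReal_rpow_of_nonneg h2 hb.le, ← ENNReal.ofReal_mul (rpow_nonneg h1 _)]
  exact ENNReal.ofReal_le_ofReal (persp hnonneg hlc ha hb hα hβ x y)

/-- For a log-concave probability density `f` on `ℝⁿ` and `p ≥ q > 0` with `p, q ≠ 1`:
`h_q(f) − h_p(f) ≤ n·(log q)/(q−1) − n·(log p)/(p−1)`,
where `h_α(f) = (1/(1-α))·log ∫ f^α`; i.e. `h_α(f) − n·(log α)/(α−1)` is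
non-decreasing in `α`. -/
theorem renyiEntropy_diff_le_of_logConcave
    (n : ℕ) (f : EuclideanSpace ℝ (Fin n) → ℝ)
    (hmeas : Measurable f) (hnonneg : ∀ x, 0 ≤ f x) (hint : ∫ x, f x = 1)
    (hlc : IsLogConcaveFnN f)
    (p q : ℝ) (hq0 : 0 < q) (hqp : q ≤ p) (hp1 : p ≠ 1) (hq1 : q ≠ 1) :
    (1 / (1 - q)) * Real.log (∫ x, f x ^ q) - (1 / (1 - p)) * Real.log (∫ x, f x ^ p)
      ≤ n * (Real.log q / (q - 1)) - n * (Real.log p / (p - 1)) := by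
  set I : ℝ → ENNReal := fun α => ∫⁻ x, ENNReal.ofReal (f x ^ α) with hI
  set Φ : ℝ → ENNReal := fun α => ENNReal.ofReal (α ^ n) * I α with hΦ
  have hineq : ∀ {a b α β : ℝ}, 0 < a → 0 < b → a + b = 1 → 0 < α → 0 < β →
      Φ α ^ a * Φ β ^ b ≤ Φ (a * α + b * β) := fun ha hb hab hα hβ =>
    phi_ineq hmeas hnonneg hlc ha hb hab hα hβ
  have hm : ∀ γ : ℝ, Measurable fun x => ENNReal.ofReal (f x ^ γ) := fun γ =>
    (hmeas.pow_const γ).ennreal_ofReal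
  have hintR : ∀ α : ℝ, ∫ x, f x ^ α = (I α).toReal := fun α =>
    integral_eq_lintegral_of_nonneg_ae (by filter_upwards with x using rpow_nonneg (hnonneg x) α)
      (hmeas.pow_const α).aestronglyMeasurable
  have hI1 : I 1 = 1 := by
    have h := hintR 1
    simp only [Real.rpow_one, hint] at h
    exact (ENNReal.toReal_eq_one_iff _).1 h.symm
  have hΦ1 : Φ 1 = 1 := by simp [hΦ, hI1]
  have hI0 : ∀ α, 0 < α → I α ≠ 0 := by
    intro α hα h0
    have h1 : I 1 = 0 := by
      simp only [hI] at h0 ⊢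
      rw [lintegral_eq_zero_iff (hm α)] at h0
      rw [lintegral_eq_zero_iff (hm 1)]
      filter_upwards [h0] with x hx
      simp only [Pi.zero_apply, ENNReal.ofReal_eq_zero] at hx ⊢
      have h2 : f x ^ α = 0 := le_antisymm hx (rpow_nonneg (hnonneg x) α)
      rw [Real.rpow_eq_zero (hnonneg x) hα.ne'] at h2
      simp [h2]
    rw [hI1] at h1
    exact one_ne_zero h1
  have hpow : ∀ α : ℝ, 0 < α → ENNReal.ofReal (α ^ n) ≠ 0 := fun α hα => by
    simpa using pow_pos hα n
  have hΦ0 : ∀ α, 0 < α → Φ α ≠ 0 := fun α hα => mul_ne_zero (hpow α hα) (hI0 α hα)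
  have hΦt : ∀ α, 0 < α → Φ α ≠ ⊤ := by
    intro α hα ht
    obtain ⟨a, b, β, ha, hb, hab, hβ, h1⟩ : ∃ a b β : ℝ, 0 < a ∧ 0 < b ∧ a + b = 1 ∧ 0 < β ∧
        a * α + b * β = 1 := by
      rcases lt_trichotomy α 1 with h | h | h
      · exact ⟨1/2, 1/2, 2 - α, by norm_num, by norm_num, by norm_num, by linarith, by ring⟩
      · rw [h, hΦ1] at ht; simp at ht
      · refine ⟨1 / (2 * α), 1 - 1 / (2 * α), (1/2) / (1 - 1 / (2 * α)), by positivity, ?_,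
          by ring, ?_, ?_⟩
        all_goals
          have h2 : 0 < 1 - 1 / (2 * α) := by
            rw [sub_pos, div_lt_one (by positivity)]; linarith
        · exact h2
        · positivity
        · rw [mul_div_cancel₀ _ h2.ne']; field_simp; norm_num
    have h := hineq ha hb hab hα hβ
    rw [h1, hΦ1, ht, ENNReal.top_rpow_of_pos ha, ENNReal.top_mul] at h
    · simp at h
    · simp [ENNReal.rpow_eq_zero_iff, hΦ0 β hβ, hb.not_gt]
  set φ : ℝ → ℝ := fun α => -Real.log (Φ α).toReal with hφ
  have hpos : ∀ α, 0 < α → 0 < (Φ α).toReal := fun α hα =>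
    ENNReal.toReal_pos (hΦ0 α hα) (hΦt α hα)
  have hconv : ConvexOn ℝ (Set.Ioi 0) φ := by
    refine convexOn_iff_forall_pos.2 ⟨convex_Ioi 0, fun α hα β hβ a b ha hb hab => ?_⟩
    simp only [Set.mem_Ioi] at hα hβ
    have h := ENNReal.toReal_mono (hΦt (a * α + b * β) (by positivity)) (hineq ha hb hab hα hβ)
    rw [ENNReal.toReal_mul, ← ENNReal.toReal_rpow, ← ENNReal.toReal_rpow] at h
    have p1 := hpos α hα
    have p2 := hpos β hβ
    have h' := Real.log_le_log (by positivity) h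
    rw [Real.log_mul (by positivity) (by positivity), Real.log_rpow p1, Real.log_rpow p2] at h'
    simp only [hφ, smul_eq_mul]
    linarith
  have hp0 : 0 < p := hq0.trans_le hqp
  have hsec := hconv.secant_mono (a := 1) (x := q) (y := p) (by simp) hq0 hp0 hq1 hp1 hqp
  have hφ1 : φ 1 = 0 := by simp [hφ, hΦ1]
  have hφα : ∀ α, 0 < α → φ α = -(n * Real.log α + Real.log (∫ x, f x ^ α)) := by
    intro α hα
    have hα' := hpos α hα
    have e : (Φ α).toReal = α ^ n * ∫ x, f x ^ α := by
      rw [hintR]; simp only [hΦ]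
      rw [ENNReal.toReal_mul, ENNReal.toReal_ofReal (by positivity)]
    rw [e] at hα'
    have h3 : (∫ x, f x ^ α) ≠ 0 := by
      intro h; rw [h, mul_zero] at hα'; exact lt_irrefl _ hα'
    simp only [hφ]
    rw [e, Real.log_mul (by positivity) h3, Real.log_pow]
  rw [hφ1, hφα q hq0, hφα p hp0] at hsec
  have hp' : p - 1 ≠ 0 := sub_ne_zero.2 hp1
  have hq' : q - 1 ≠ 0 := sub_ne_zero.2 hq1
  have e : ∀ α L l : ℝ, α - 1 ≠ 0 → (-(n * l + L) - 0) / (α - 1) =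
      1 / (1 - α) * L - n * (l / (α - 1)) := by
    intro α L l h
    have h' : 1 - α ≠ 0 := fun h2 => h (by linarith)
    rw [← neg_sub α 1, one_div, inv_neg]
    field_simp
    ring
  rw [e q _ _ hq', e p _ _ hp'] at hsec
  linarith
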